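/- Let f be K-bandlimited on the circle, N ≥ 2K+1, y_n := f(2πn/N), and let q_0,…,q_{N−1} ∈ ℝ be arbitrary, with reconstruction f_q(t) = (1/N) Σ_{n=0}^{N−1} q_n φ^K(t − 2πn/N). Then sup_t |f(t) − f_q(t)| ≥ (1/N)·|Σ_{n=0}^{N−1} y_n − Σ_{n=0}^{N−1} q_n|. -/

import Mathlib

noncomputable section
open Real
open scoped Classical

/-- The Dirichlet kernel `φᴷ`. -/
def dirichlet (K : ℕ) (x : ℝ) : ℝ :=
  if ∃ m : ℤ, x = 2 * π * m then 2 * K + 1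
  else Real.sin ((2 * K + 1) * x / 2) / Real.sin (x / 2)

/-- `f : ℝ → ℝ` is `K`-bandlimited on the circle. -/
def KBandlimited (K : ℕ) (f : ℝ → ℝ) : Prop :=
  ∃ c : ℤ → ℂ, ∀ t : ℝ, (f t : ℂ) =
    ∑ ξ ∈ Finset.Icc (-(K : ℤ)) (K : ℤ), c ξ * Complex.exp (Complex.I * ξ * t)

theorem dirichlet_eq_sum_cos (K : ℕ) (x : ℝ) :
    dirichlet K x = 1 + 2 * ∑ j ∈ Finset.range K, Real.cos ((j + 1) * x) := by
  unfold dirichlet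
  split_ifs with h
  · obtain ⟨m, rfl⟩ := h
    have hcos (j : ℕ) : Real.cos ((j + 1) * (2 * π * m)) = 1 := by
      refine Eq.trans (congrArg Real.cos ?_) (Real.cos_int_mul_two_pi ((j + 1) * m))
      push_cast
      ring
    simp only [hcos, Finset.sum_const, Finset.card_range, nsmul_eq_mul]
    ring
  · have hs : Real.sin (x / 2) ≠ 0 := by
      intro h0
      obtain ⟨m, hm⟩ := Real.sin_eq_zero_iff.mp h0
      exact h ⟨m, by linarith⟩
    rw [div_eq_iff hs]
    induction K with
    | zero => simp
    | succ k ih =>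
      have hdiff : Real.sin ((2 * ((k + 1 : ℕ) : ℝ) + 1) * x / 2) - Real.sin ((2 * k + 1) * x / 2) =
          2 * Real.cos ((k + 1) * x) * Real.sin (x / 2) := by
        rw [Real.sin_sub_sin]
        push_cast
        ring_nf
      rw [Finset.sum_range_succ]
      linear_combination ih + hdiff

theorem abs_dirichlet_le (K : ℕ) (x : ℝ) : |dirichlet K x| ≤ 1 + 2 * K := by
  rw [dirichlet_eq_sum_cos]
  have h : |∑ j ∈ Finset.range K, Real.cos ((j + 1) * x)| ≤ K := by
    refine (Finset.abs_sum_le_sum_abs _ _).trans ?_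
    refine (Finset.sum_le_sum fun j _ => Real.abs_cos_le_one _).trans ?_
    simp
  rw [abs_le] at h ⊢
  constructor <;> linarith [h.1, h.2]

/-- A nontrivial harmonic below the sampling rate has vanishing sum over the sampling grid. -/
theorem sum_cos_grid_eq_zero {N k : ℕ} (hk : k ≠ 0) (hkN : k < N) (a : ℝ) :
    ∑ m ∈ Finset.range N, Real.cos (k * (2 * π * m / N - a)) = 0 := by
  have hN : N ≠ 0 := by omega
  have hζ := Complex.isPrimitiveRoot_exp N hN
  set ζ := Complex.exp (2 * π * Complex.I / N) with hζ_def
  have hgeom : ∑ m ∈ Finset.range N, (ζ ^ k) ^ m = 0 := by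
    have hne : ζ ^ k - 1 ≠ 0 := sub_ne_zero.mpr (hζ.pow_ne_one_of_pos_of_lt hk hkN)
    refine (mul_eq_zero.mp ?_).resolve_right hne
    rw [geom_sum_mul, ← pow_mul, mul_comm, pow_mul, hζ.pow_eq_one, one_pow, sub_self]
  have hterm (m : ℕ) : Real.cos (k * (2 * π * m / N - a)) =
      (Complex.exp (((-(k * a) : ℝ) : ℂ) * Complex.I) * (ζ ^ k) ^ m).re := by
    rw [← Complex.exp_ofReal_mul_I_re, hζ_def, ← Complex.exp_nat_mul, ← Complex.exp_nat_mul,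
      ← Complex.exp_add]
    congr 2
    push_cast
    ring
  simp_rw [hterm]
  rw [← Complex.re_sum, ← Finset.mul_sum, hgeom, mul_zero, Complex.zero_re]

theorem sum_dirichlet_grid {K N : ℕ} (hN : K < N) (a : ℝ) :
    ∑ m ∈ Finset.range N, dirichlet K (2 * π * m / N - a) = N := by
  simp_rw [dirichlet_eq_sum_cos]
  rw [Finset.sum_add_distrib, ← Finset.mul_sum, Finset.sum_comm]
  have hzero : ∑ j ∈ Finset.range K, ∑ m ∈ Finset.range N,
      Real.cos (((j : ℝ) + 1) * (2 * π * m / N - a)) = 0 := by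
    refine Finset.sum_eq_zero fun j hj => ?_
    have hj' := Finset.mem_range.mp hj
    simpa using sum_cos_grid_eq_zero (N := N) (Nat.succ_ne_zero j) (by omega) a
  rw [hzero]
  simp

theorem KBandlimited.exists_abs_le {K : ℕ} {f : ℝ → ℝ} (hf : KBandlimited K f) :
    ∃ C : ℝ, ∀ t, |f t| ≤ C := by
  obtain ⟨c, hc⟩ := hf
  refine ⟨∑ ξ ∈ Finset.Icc (-(K : ℤ)) (K : ℤ), ‖c ξ‖, fun t => ?_⟩
  rw [← Real.norm_eq_abs, ← Complex.norm_real, hc t]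
  refine norm_sum_le_of_le _ fun ξ _ => ?_
  have hexp : Complex.I * ξ * t = ((ξ * t : ℝ) : ℂ) * Complex.I := by
    push_cast
    ring
  rw [norm_mul, hexp, Complex.norm_exp_ofReal_mul_I, mul_one]

/-- **Averaging lower bound for reconstruction on the circle.**
If `f` is `K`-bandlimited, `N ≥ 2K+1`, `yₙ = f(2πn/N)` and `q₀,…,q_{N-1}` are
arbitrary, then the reconstruction `f_q(t) = (1/N) ∑ₙ qₙ φᴷ(t - 2πn/N)` satisfies
`supₜ |f(t) - f_q(t)| ≥ (1/N)·|∑ₙ yₙ - ∑ₙ qₙ|`. -/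
theorem reconstruction_lower_bound (K N : ℕ) (hN : 2 * K + 1 ≤ N)
    (f : ℝ → ℝ) (hf : KBandlimited K f) (q : ℕ → ℝ) :
    (1 / N) * |(∑ n ∈ Finset.range N, f (2 * π * n / N)) - ∑ n ∈ Finset.range N, q n| ≤
      ⨆ t : ℝ, |f t - (1 / N) * ∑ n ∈ Finset.range N,
        q n * dirichlet K (t - 2 * π * n / N)| := by
  have hN0 : (0 : ℝ) < N := by exact_mod_cast (by omega : 0 < N)
  set g : ℝ → ℝ := fun t => f t - (1 / N) * ∑ n ∈ Finset.range N,
    q n * dirichlet K (t - 2 * π * n / N) with hg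
  have hbdd : BddAbove (Set.range fun t => |g t|) := by
    obtain ⟨C, hC⟩ := hf.exists_abs_le
    refine ⟨C + (1 / N) * ∑ n ∈ Finset.range N, |q n| * (1 + 2 * K), ?_⟩
    rintro _ ⟨t, rfl⟩
    refine (abs_sub _ _).trans (add_le_add (hC t) ?_)
    rw [abs_mul, abs_of_pos (one_div_pos.mpr hN0)]
    gcongr
    refine (Finset.abs_sum_le_sum_abs _ _).trans (Finset.sum_le_sum fun n _ => ?_)
    rw [abs_mul]
    gcongr
    exact abs_dirichlet_le K _
  have hsum : ∑ m ∈ Finset.range N, g (2 * π * m / N) =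
      (∑ n ∈ Finset.range N, f (2 * π * n / N)) - ∑ n ∈ Finset.range N, q n := by
    simp only [hg]
    rw [Finset.sum_sub_distrib, ← Finset.mul_sum, Finset.sum_comm]
    simp_rw [← Finset.mul_sum, sum_dirichlet_grid (show K < N by omega)]
    rw [← Finset.sum_mul]
    field_simp
  change _ ≤ ⨆ t, |g t|
  rw [← hsum, one_div, inv_mul_le_iff₀ hN0]
  refine (Finset.abs_sum_le_sum_abs _ _).trans ?_
  refine (Finset.sum_le_sum fun (m : ℕ) _ => le_ciSup hbdd (2 * π * m / N)).trans_eq ?_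
  simp
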